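/- arXiv:1410.7353 — 2 statements merged into one kernel-verified Lean document; each statement's English description precedes it below -/
import Mathlib

section
/- For distinct nonzero complex numbers h₁, …, h_N such that the 4N phases {kπ/2 − arg(hᵢ) : k ∈ {0,1,2,3}, 1 ≤ i ≤ N} are pairwise distinct modulo 2π, the map x ↦ (sgn(Re(hᵢ·x)), sgn(Im(hᵢ·x)))_{i=1}^N takes exactly 4N distinct values as x ranges over nonzero complex numbers with arg(x) avoiding those 4N phases. -/
open Filter Topology in
/-- A point off finitely many lines can be moved slightly in any direction without changing sides. -/
lemma exists_pos_perturbation {ι : Type*} (g : ι → ℂ) (s : Finset ι) (x y : ℂ)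
    (hx : ∀ i ∈ s, (g i * x).re ≠ 0) :
    ∃ t : ℝ, 0 < t ∧ ∀ i ∈ s, (g i * (x + t * y)).re ≠ 0 ∧
      (0 < (g i * (x + t * y)).re ↔ 0 < (g i * x).re) := by
  have key : ∀ᶠ t : ℝ in 𝓝[>] 0, ∀ i ∈ s, (g i * (x + t * y)).re ≠ 0 ∧
      (0 < (g i * (x + t * y)).re ↔ 0 < (g i * x).re) := by
    rw [eventually_all_finset]
    intro i hi
    have hc : Tendsto (fun t : ℝ => (g i * (x + t * y)).re) (𝓝[>] 0) (𝓝 (g i * x).re) := by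
      have : Continuous (fun t : ℝ => (g i * (x + t * y)).re) := by fun_prop
      simpa using (this.tendsto 0).mono_left nhdsWithin_le_nhds
    rcases lt_or_gt_of_ne (hx i hi) with h | h
    · filter_upwards [hc.eventually_lt_const h] with t ht
      exact ⟨ht.ne, by constructor <;> intro <;> linarith⟩
    · filter_upwards [hc.eventually_const_lt h] with t ht
      exact ⟨ht.ne', by constructor <;> intro <;> linarith⟩
  obtain ⟨t, ht, h⟩ := (eventually_mem_nhdsWithin.and key).exists
  exact ⟨t, ht, h⟩

/-- The indices in `s` whose functional `x ↦ Re (g i * x)` is positive at `x`. -/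
def positiveSide {ι : Type*} (g : ι → ℂ) (s : Finset ι) (x : ℂ) : Set ι :=
  {i | i ∈ s ∧ 0 < (g i * x).re}

/-- The points lying on none of the lines `Re (g i * x) = 0`, `i ∈ s`. -/
def offLines {ι : Type*} (g : ι → ℂ) (s : Finset ι) : Set ℂ :=
  {x | ∀ i ∈ s, (g i * x).re ≠ 0}

lemma positiveSide_eq_iff {ι : Type*} {g : ι → ℂ} {s : Finset ι} {x y : ℂ} :
    positiveSide g s x = positiveSide g s y ↔
      ∀ i ∈ s, (0 < (g i * x).re ↔ 0 < (g i * y).re) := by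
  simp only [positiveSide, Set.ext_iff, Set.mem_ofPred_eq]
  grind

lemma exists_perturbation_positiveSide {ι : Type*} {g : ι → ℂ} {s : Finset ι} {x : ℂ}
    (hx : x ∈ offLines g s) (y : ℂ) :
    ∃ t : ℝ, 0 < t ∧ x + t * y ∈ offLines g s ∧
      positiveSide g s (x + t * y) = positiveSide g s x := by
  obtain ⟨t, ht, h⟩ := exists_pos_perturbation g s x y hx
  exact ⟨t, ht, fun i hi => (h i hi).1, positiveSide_eq_iff.2 fun i hi => (h i hi).2⟩

lemma re_mul_conj_pos {z : ℂ} (hz : z ≠ 0) : 0 < (z * starRingEnd ℂ z).re := by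
  rw [Complex.mul_conj, Complex.ofReal_re]
  exact Complex.normSq_pos.2 hz

/-- The line `Re (z * x) = 0` is spanned by `I * conj z`. -/
lemma exists_eq_real_mul_of_re_mul_eq_zero {z x : ℂ} (hz : z ≠ 0) (h : (z * x).re = 0) :
    ∃ r : ℝ, x = r * (Complex.I * starRingEnd ℂ z) := by
  refine ⟨(z * x).im / Complex.normSq z, mul_left_cancel₀ hz ?_⟩
  have hn : (Complex.normSq z : ℂ) ≠ 0 := by
    exact_mod_cast (Complex.normSq_pos.2 hz).ne'
  have hzx : z * x = ((z * x).im : ℂ) * Complex.I := by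
    apply Complex.ext <;> simp [-Complex.mul_re, -Complex.mul_im, h, Complex.re_ofReal_mul,
      Complex.im_ofReal_mul]
  calc z * x = ((z * x).im : ℂ) * Complex.I := hzx
    _ = ((z * x).im : ℂ) / Complex.normSq z * (Complex.I * (z * starRingEnd ℂ z)) := by
      rw [Complex.mul_conj]; field_simp
    _ = _ := by push_cast; ring

/-- The regions of `s` meeting the open half-plane `0 < Re (z * x)`. -/
def regionsMeeting {ι : Type*} (g : ι → ℂ) (s : Finset ι) (z : ℂ) : Set (Set ι) :=
  positiveSide g s '' (offLines g s ∩ {x | 0 < (z * x).re})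

lemma positiveSide_mem_regionsMeeting {ι : Type*} {g : ι → ℂ} {s : Finset ι} {z x : ℂ}
    (hz : z ≠ 0) (hx : x ∈ offLines g s) (h : (z * x).re = 0) :
    positiveSide g s x ∈ regionsMeeting g s z := by
  obtain ⟨t, ht, hmem, heq⟩ := exists_perturbation_positiveSide hx (starRingEnd ℂ z)
  refine ⟨_, ⟨hmem, ?_⟩, heq⟩
  have : (z * (x + t * starRingEnd ℂ z)).re =
      (z * x).re + t * (z * starRingEnd ℂ z).re := by
    rw [← Complex.re_ofReal_mul, ← Complex.add_re]; ring_nf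
  rw [Set.mem_ofPred_eq, this, h, zero_add]
  exact mul_pos ht (re_mul_conj_pos hz)

lemma regionsMeeting_union_neg {ι : Type*} (g : ι → ℂ) (s : Finset ι) {z : ℂ} (hz : z ≠ 0) :
    regionsMeeting g s z ∪ regionsMeeting g s (-z) = positiveSide g s '' offLines g s := by
  apply Set.Subset.antisymm
  · exact Set.union_subset (Set.image_mono Set.inter_subset_left)
      (Set.image_mono Set.inter_subset_left)
  · rintro _ ⟨x, hx, rfl⟩
    rcases lt_trichotomy (z * x).re 0 with h | h | h
    · exact Or.inr ⟨x, ⟨hx, by simpa [-Complex.mul_re] using h⟩, rfl⟩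
    · exact Or.inl (positiveSide_mem_regionsMeeting hz hx h)
    · exact Or.inl ⟨x, ⟨hx, h⟩, rfl⟩

lemma positiveSide_real_mul {ι : Type*} (g : ι → ℂ) (s : Finset ι) {r : ℝ} (hr : 0 < r) (v : ℂ) :
    positiveSide g s (r * v) = positiveSide g s v := by
  refine positiveSide_eq_iff.2 fun i _ => ?_
  rw [mul_left_comm, Complex.re_ofReal_mul, mul_pos_iff_of_pos_left hr]

/-- A new line through the origin crosses exactly the two regions containing its two rays. -/
lemma regionsMeeting_inter_neg {ι : Type*} {g : ι → ℂ} {s : Finset ι} (hs : s.Nonempty) {z : ℂ}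
    (hz : z ≠ 0) (hv : Complex.I * starRingEnd ℂ z ∈ offLines g s) :
    regionsMeeting g s z ∩ regionsMeeting g s (-z) =
      {positiveSide g s (Complex.I * starRingEnd ℂ z),
        positiveSide g s (-(Complex.I * starRingEnd ℂ z))} := by
  set v := Complex.I * starRingEnd ℂ z with hv_def
  have hzv : (z * v).re = 0 := by
    rw [hv_def, mul_left_comm, Complex.mul_conj]; simp
  apply Set.Subset.antisymm
  · rintro T ⟨⟨x, ⟨hx, hxz⟩, rfl⟩, ⟨y, ⟨hy, hyz⟩, hyT⟩⟩
    rw [positiveSide_eq_iff] at hyT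
    set a := (z * x).re
    have hyz' : 0 < -(z * y).re := by simpa [-Complex.mul_re] using hyz
    set b := -(z * y).re with hb
    have ha : 0 < a := hxz
    have hexp : ∀ c : ℂ, (c * (b * x + a * y)).re = b * (c * x).re + a * (c * y).re := by
      intro c
      rw [← Complex.re_ofReal_mul, ← Complex.re_ofReal_mul, ← Complex.add_re]; ring_nf
    have hsame : ∀ i ∈ s, (g i * (b * x + a * y)).re ≠ 0 ∧
        (0 < (g i * (b * x + a * y)).re ↔ 0 < (g i * x).re) := by
      intro i hi
      have h1 := hx i hi
      have h2 := hy i hi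
      have h3 := hyT i hi
      rw [hexp]
      rcases lt_or_gt_of_ne h1 with h | h
      · have h4 : (g i * y).re < 0 := lt_of_le_of_ne (not_lt.1 (by rw [h3]; exact h.not_gt)) h2
        have : b * (g i * x).re + a * (g i * y).re < 0 :=
          add_neg (mul_neg_of_pos_of_neg hyz' h) (mul_neg_of_pos_of_neg ha h4)
        exact ⟨this.ne, by constructor <;> intro <;> linarith⟩
      · have : 0 < b * (g i * x).re + a * (g i * y).re :=
          add_pos (mul_pos hyz' h) (mul_pos ha (h3.2 h))
        exact ⟨this.ne', by simp only [this, h]⟩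
    obtain ⟨r, hr⟩ := exists_eq_real_mul_of_re_mul_eq_zero (x := b * x + a * y) hz
      (by rw [hexp]; simp only [hb, a]; ring)
    rw [← positiveSide_eq_iff.2 fun i hi => (hsame i hi).2, hr]
    rcases lt_trichotomy r 0 with h | h | h
    · right
      rw [show (r : ℂ) * (Complex.I * starRingEnd ℂ z) = ((-r : ℝ) : ℂ) * -v by
        push_cast; rw [hv_def]; ring]
      exact positiveSide_real_mul g s (neg_pos.2 h) _
    · obtain ⟨i, hi⟩ := hs
      exact absurd (by rw [hr, h]; simp) (hsame i hi).1
    · left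
      exact positiveSide_real_mul g s h _
  · have hv' : -v ∈ offLines g s := fun i hi => by
      simpa [-Complex.mul_re] using hv i hi
    have hz' : -z ≠ 0 := neg_ne_zero.2 hz
    rintro T (rfl | rfl)
    · exact ⟨positiveSide_mem_regionsMeeting hz hv hzv,
        positiveSide_mem_regionsMeeting hz' hv (by simpa [-Complex.mul_re] using hzv)⟩
    · exact ⟨positiveSide_mem_regionsMeeting hz hv' (by simpa [-Complex.mul_re] using hzv),
        positiveSide_mem_regionsMeeting hz' hv' (by simpa [-Complex.mul_re] using hzv)⟩

lemma positiveSide_ne_neg {ι : Type*} {g : ι → ℂ} {s : Finset ι} (hs : s.Nonempty) {v : ℂ}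
    (hv : v ∈ offLines g s) : positiveSide g s v ≠ positiveSide g s (-v) := by
  obtain ⟨i, hi⟩ := hs
  intro h
  have h1 := positiveSide_eq_iff.1 h i hi
  have h2 := hv i hi
  rw [mul_neg, Complex.neg_re, neg_pos] at h1
  rcases lt_or_gt_of_ne h2 with h3 | h3
  · exact h3.not_gt (h1.2 h3)
  · exact h3.not_gt (h1.1 h3)

lemma positiveSide_image_cons {ι : Type*} (g : ι → ℂ) (s : Finset ι) {a : ι} (ha : a ∉ s) :
    positiveSide g (s.cons a ha) '' offLines g (s.cons a ha) =
      insert a '' regionsMeeting g s (g a) ∪ regionsMeeting g s (-g a) := by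
  have hpos : ∀ x, 0 < (g a * x).re →
      positiveSide g (s.cons a ha) x = insert a (positiveSide g s x) := by
    intro x hx
    ext i
    simp only [positiveSide, Finset.mem_cons, Set.mem_ofPred_eq, Set.mem_insert_iff]
    grind
  have hneg : ∀ x, (g a * x).re < 0 →
      positiveSide g (s.cons a ha) x = positiveSide g s x := by
    intro x hx
    ext i
    simp only [positiveSide, Finset.mem_cons, Set.mem_ofPred_eq]
    grind
  apply Set.Subset.antisymm
  · rintro _ ⟨x, hx, rfl⟩
    have hxs : x ∈ offLines g s := fun i hi => hx i (Finset.mem_cons_of_mem hi)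
    rcases lt_or_gt_of_ne (hx a (Finset.mem_cons_self a s)) with h | h
    · exact Or.inr ⟨x, ⟨hxs, by simpa [-Complex.mul_re] using h⟩, (hneg x h).symm⟩
    · exact Or.inl ⟨_, ⟨x, ⟨hxs, h⟩, rfl⟩, (hpos x h).symm⟩
  · rintro _ (⟨_, ⟨x, ⟨hx, h⟩, rfl⟩, rfl⟩ | ⟨x, ⟨hx, h⟩, rfl⟩)
    · have h' : 0 < (g a * x).re := h
      refine ⟨x, ?_, hpos x h'⟩
      intro i hi
      rcases Finset.mem_cons.1 hi with rfl | hi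
      · exact h'.ne'
      · exact hx i hi
    · have h' : (g a * x).re < 0 := by simpa [-Complex.mul_re] using h
      refine ⟨x, ?_, hneg x h'⟩
      intro i hi
      rcases Finset.mem_cons.1 hi with rfl | hi
      · exact h'.ne
      · exact hx i hi

/-- Adding a line to an arrangement counts the regions on each side of it separately. -/
lemma ncard_positiveSide_image_cons {ι : Type*} [Finite ι] (g : ι → ℂ) (s : Finset ι) {a : ι}
    (ha : a ∉ s) (hz : g a ≠ 0) :
    (positiveSide g (s.cons a ha) '' offLines g (s.cons a ha)).ncard =
      (positiveSide g s '' offLines g s).ncard +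
        (regionsMeeting g s (g a) ∩ regionsMeeting g s (-g a)).ncard := by
  have hmem : ∀ z, ∀ T ∈ regionsMeeting g s z, a ∉ T := by
    rintro z _ ⟨x, -, rfl⟩ h
    exact ha h.1
  rw [positiveSide_image_cons, Set.ncard_union_eq, Set.InjOn.ncard_image,
    ← regionsMeeting_union_neg g s hz, Set.ncard_union_add_ncard_inter]
  · intro T hT U hU h
    rw [← Set.insert_sdiff_self_of_notMem (hmem _ T hT), h,
      Set.insert_sdiff_self_of_notMem (hmem _ U hU)]
  · rw [Set.disjoint_left]
    rintro _ ⟨T, -, rfl⟩ h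
    exact hmem _ _ h (Set.mem_insert a T)

/-- An arrangement of `m ≥ 1` distinct lines through the origin cuts the plane into `2 * m`
regions. -/
lemma ncard_positiveSide_image {ι : Type*} [Finite ι] (g : ι → ℂ) (hg : ∀ i, g i ≠ 0)
    (hind : ∀ i j x, (g i * x).re = 0 → (g j * x).re = 0 → x ≠ 0 → i = j)
    (s : Finset ι) (hs : s.Nonempty) :
    (positiveSide g s '' offLines g s).ncard = 2 * s.card := by
  induction hs using Finset.Nonempty.cons_induction with
  | singleton a =>
    have h0 : ∀ z : ℂ, z ≠ 0 → regionsMeeting g ∅ z = {∅} := by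
      intro z hz
      apply Set.Subset.antisymm
      · rintro _ ⟨x, -, rfl⟩
        simp [positiveSide]
      · rintro _ rfl
        exact ⟨starRingEnd ℂ z, ⟨by simp [offLines], re_mul_conj_pos hz⟩,
          by simp [positiveSide]⟩
    have := ncard_positiveSide_image_cons g ∅ (Finset.notMem_empty a) (hg a)
    rw [← regionsMeeting_union_neg g ∅ (hg a), h0 _ (hg a), h0 _ (neg_ne_zero.2 (hg a))] at this
    simpa using this
  | cons a s ha hs ih =>
    have hv : Complex.I * starRingEnd ℂ (g a) ∈ offLines g s := by
      intro i hi h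
      refine ha (hind a i _ ?_ h ?_ ▸ hi)
      · rw [mul_left_comm, Complex.mul_conj]; simp
      · simpa using hg a
    rw [ncard_positiveSide_image_cons g s ha (hg a), ih,
      regionsMeeting_inter_neg hs (hg a) hv, Set.ncard_pair (positiveSide_ne_neg hs hv),
      Finset.card_cons]
    ring

lemma exp_I_mul_phase (k : ℕ) {z : ℂ} (hz : z ≠ 0) :
    Complex.exp (Complex.I * ((k : ℂ) * Real.pi / 2 - (Complex.arg z : ℂ))) =
      Complex.I ^ k * (‖z‖ / z) := by
  have h1 : Complex.exp (Complex.arg z * Complex.I) = z / ‖z‖ := by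
    rw [eq_div_iff (by simpa using hz), mul_comm]
    exact Complex.norm_mul_exp_arg_mul_I z
  have h2 : Complex.I * ((k : ℂ) * Real.pi / 2 - (Complex.arg z : ℂ)) =
      k * (Real.pi / 2 * Complex.I) - Complex.arg z * Complex.I := by ring
  rw [h2, Complex.exp_sub, Complex.exp_nat_mul, Complex.exp_pi_div_two_mul_I, h1,
    div_eq_mul_inv, inv_div]

lemma norm_div_eq_exp_phase (k : ℕ) {z x : ℂ} (hz : z ≠ 0) (hx : x ≠ 0)
    (h : z * x = Complex.I ^ k * (‖z * x‖ : ℝ)) :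
    Complex.exp (Complex.I * ((k : ℂ) * Real.pi / 2 - (Complex.arg z : ℂ))) = x / ‖x‖ := by
  have hx' : (‖x‖ : ℂ) ≠ 0 := by simpa using hx
  rw [exp_I_mul_phase k hz]
  rw [norm_mul, Complex.ofReal_mul] at h
  field_simp
  linear_combination -h

/-- A nonzero `x` with `Re (z * x) = 0` points along one of the odd phases of `z`. -/
lemma exists_odd_phase {z x : ℂ} (hz : z ≠ 0) (hx : x ≠ 0) (h : (z * x).re = 0) :
    ∃ k : Fin 4, (k : ℕ) % 2 = 1 ∧
      Complex.exp (Complex.I * (((k : ℕ) : ℂ) * Real.pi / 2 - (Complex.arg z : ℂ))) =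
        x / ‖x‖ := by
  have hw : z * x = ((z * x).im : ℂ) * Complex.I := by
    apply Complex.ext <;> simp [-Complex.mul_re, -Complex.mul_im, h, Complex.re_ofReal_mul,
      Complex.im_ofReal_mul]
  have hn : ‖z * x‖ = |(z * x).im| := by
    conv_lhs => rw [hw]
    simp [-Complex.mul_im]
  rcases le_total 0 (z * x).im with h0 | h0
  · refine ⟨1, rfl, norm_div_eq_exp_phase 1 hz hx ?_⟩
    rw [hn, abs_of_nonneg h0, pow_one, mul_comm Complex.I]
    exact hw
  · refine ⟨3, rfl, norm_div_eq_exp_phase 3 hz hx ?_⟩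
    rw [hn, abs_of_nonpos h0, Complex.I_pow_three]
    conv_lhs => rw [hw]
    push_cast
    ring

/-- A nonzero `x` with `Im (z * x) = 0` points along one of the even phases of `z`. -/
lemma exists_even_phase {z x : ℂ} (hz : z ≠ 0) (hx : x ≠ 0) (h : (z * x).im = 0) :
    ∃ k : Fin 4, (k : ℕ) % 2 = 0 ∧
      Complex.exp (Complex.I * (((k : ℕ) : ℂ) * Real.pi / 2 - (Complex.arg z : ℂ))) =
        x / ‖x‖ := by
  have hw : z * x = ((z * x).re : ℂ) := by
    apply Complex.ext <;> simp [-Complex.mul_re, -Complex.mul_im, h]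
  have hn : ‖z * x‖ = |(z * x).re| := by
    conv_lhs => rw [hw]
    simp [-Complex.mul_re]
  rcases le_total 0 (z * x).re with h0 | h0
  · refine ⟨0, rfl, norm_div_eq_exp_phase 0 hz hx ?_⟩
    rw [hn, abs_of_nonneg h0, pow_zero, one_mul]
    exact hw
  · refine ⟨2, rfl, norm_div_eq_exp_phase 2 hz hx ?_⟩
    rw [hn, abs_of_nonpos h0, Complex.I_sq]
    conv_lhs => rw [hw]
    push_cast
    ring


/-- For distinct nonzero channel coefficients `h₁, …, h_N` whose associated `4N`
phases `kπ/2 - arg hᵢ` are pairwise distinct modulo `2π`, the one-bit quantization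
map `x ↦ (sgn Re(hᵢ x), sgn Im(hᵢ x))ᵢ` takes exactly `4N` distinct values on the
set of nonzero `x` avoiding those phases (equivalently, with all `Re(hᵢ x)` and
`Im(hᵢ x)` nonzero). -/
theorem simo_one_bit_output_count (N : ℕ) (hN : 0 < N) (h : Fin N → ℂ)
    (hne : ∀ i, h i ≠ 0) (hinj : Function.Injective h)
    (hphase : Function.Injective (fun p : Fin 4 × Fin N =>
      Complex.exp (Complex.I *
        (((p.1 : ℕ) : ℂ) * Real.pi / 2 - (Complex.arg (h p.2) : ℂ))))) :
    Set.ncard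
      ((fun x : ℂ => fun i : Fin N => (0 < (h i * x).re, 0 < (h i * x).im)) ''
        {x : ℂ | x ≠ 0 ∧ ∀ i, (h i * x).re ≠ 0 ∧ (h i * x).im ≠ 0}) = 4 * N := by
  let g : Fin N × Bool → ℂ := fun p => if p.2 then -Complex.I * h p.1 else h p.1
  have hre : ∀ i x, (g (i, false) * x).re = (h i * x).re := fun i x => rfl
  have him : ∀ i x, (g (i, true) * x).re = (h i * x).im := by
    intro i x
    simp [g, mul_assoc, -Complex.mul_im]
  have hg : ∀ p, g p ≠ 0 := by
    rintro ⟨i, b⟩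
    cases b <;> simp [g, hne i]
  have hphase_of_mem : ∀ p x, (g p * x).re = 0 → x ≠ 0 → ∃ k : Fin 4,
      (k : ℕ) % 2 = (if p.2 then 0 else 1) ∧
      Complex.exp (Complex.I * (((k : ℕ) : ℂ) * Real.pi / 2 - (Complex.arg (h p.1) : ℂ))) =
        x / ‖x‖ := by
    rintro ⟨i, b⟩ x hp hx
    cases b
    · exact exists_odd_phase (hne i) hx (by rwa [hre] at hp)
    · exact exists_even_phase (hne i) hx (by rwa [him] at hp)
  have hind : ∀ p q x, (g p * x).re = 0 → (g q * x).re = 0 → x ≠ 0 → p = q := by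
    rintro ⟨i, b⟩ ⟨j, c⟩ x hp hq hx
    obtain ⟨k, hk, hkx⟩ := hphase_of_mem _ x hp hx
    obtain ⟨l, hl, hlx⟩ := hphase_of_mem _ x hq hx
    obtain ⟨rfl, rfl⟩ := Prod.mk.inj (@hphase (k, i) (l, j) (hkx.trans hlx.symm))
    cases b <;> cases c <;> simp_all
  have hcount := ncard_positiveSide_image g hg hind Finset.univ
    ⟨(⟨0, hN⟩, false), Finset.mem_univ _⟩
  let F : Set (Fin N × Bool) → Fin N → Prop × Prop := fun T i => ((i, false) ∈ T, (i, true) ∈ T)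
  have hF : Function.Injective F := by
    intro T U hTU
    ext ⟨i, b⟩
    have := Prod.mk.inj (congrFun hTU i)
    cases b
    · exact iff_of_eq this.1
    · exact iff_of_eq this.2
  have hdom : {x : ℂ | x ≠ 0 ∧ ∀ i, (h i * x).re ≠ 0 ∧ (h i * x).im ≠ 0} =
      offLines g Finset.univ := by
    ext x
    simp only [offLines, Set.mem_ofPred_eq, Finset.mem_univ, true_imp_iff, Prod.forall,
      Bool.forall_bool, hre, him]
    refine ⟨fun hx => hx.2, fun hx => ⟨?_, hx⟩⟩
    rintro rfl
    exact (hx ⟨0, hN⟩).1 (by simp)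
  have hmap : (fun x : ℂ => fun i : Fin N => (0 < (h i * x).re, 0 < (h i * x).im)) =
      F ∘ positiveSide g Finset.univ := by
    funext x i
    simp only [F, positiveSide, Function.comp, Set.mem_ofPred_eq, Finset.mem_univ, true_and,
      hre, him]
  rw [hdom, hmap, Set.image_comp, Set.ncard_image_of_injective _ hF, hcount]
  simp
  ring
end

section
/- Let a_r(φ_ℓ, θ_ℓ) ∈ ℂ^N, ℓ = 1,…,L with L ≤ N, be array response vectors of a uniform planar array with entries of the form (1/√N)·e^{j k(m sin φ_ℓ sin θ_ℓ + n cos θ_ℓ)}. If the pairs of direction parameters (sin φ_ℓ sin θ_ℓ, cos θ_ℓ) are distinct and algebraically independent in a suitable generic sense, then the real 2N × 2L matrix [Re A, −Im A; Im A, Re A] built from A = [a_r(φ₁,θ₁),…,a_r(φ_L,θ_L)] has every 2L × 2L submatrix invertible (i.e., its rows are in general position) for almost every choice of angles (φ_ℓ, θ_ℓ) with respect to Lebesgue measure. -/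
/-- Entry of a uniform planar array response vector: for element `(m, n)` of a
`Y × Z` array (with `N = YZ`), at azimuth `φ` and elevation `θ`, the entry is
`(1/√N) e^{j k (m sin φ sin θ + n cos θ)}`. -/
noncomputable def upaEntry (Y Z : ℕ) (k : ℝ) (φ θ : ℝ) (mn : Fin Y × Fin Z) : ℂ :=
  ((1 / Real.sqrt ((Y : ℝ) * Z) : ℝ) : ℂ) *
    Complex.exp (Complex.I *
      ((k * ((mn.1 : ℝ) * Real.sin φ * Real.sin θ + (mn.2 : ℝ) * Real.cos θ) : ℝ) : ℂ))

/-- The real `2N × 2L` matrix `[Re A, -Im A; Im A, Re A]` built from the array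
response matrix `A = [a(φ₁,θ₁), …, a(φ_L,θ_L)]`, as a function of the angle
tuple `ang = (φ, θ)`. -/
noncomputable def upaRealMat (Y Z L : ℕ) (k : ℝ)
    (ang : (Fin L → ℝ) × (Fin L → ℝ)) :
    Matrix ((Fin Y × Fin Z) ⊕ (Fin Y × Fin Z)) (Fin L ⊕ Fin L) ℝ :=
  fun p q =>
    match p, q with
    | Sum.inl mn, Sum.inl l => (upaEntry Y Z k (ang.1 l) (ang.2 l) mn).re
    | Sum.inl mn, Sum.inr l => -(upaEntry Y Z k (ang.1 l) (ang.2 l) mn).im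
    | Sum.inr mn, Sum.inl l => (upaEntry Y Z k (ang.1 l) (ang.2 l) mn).im
    | Sum.inr mn, Sum.inr l => (upaEntry Y Z k (ang.1 l) (ang.2 l) mn).re

open MeasureTheory Filter Topology

theorem ae_ne_zero_of_analyticOnNhd {E : Type*} [NormedAddCommGroup E] [NormedSpace ℝ E]
    [FiniteDimensional ℝ E] [MeasurableSpace E] [BorelSpace E] (μ : Measure E)
    [μ.IsAddHaarMeasure] {F : E → ℝ} (hF : AnalyticOnNhd ℝ F Set.univ) {x₀ : E}
    (hx₀ : F x₀ ≠ 0) : ∀ᵐ x ∂μ, F x ≠ 0 := by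
  have hline : ∀ v : E, ∀ᵐ t : ℝ, F (x₀ + t • v) ≠ 0 := by
    intro v
    have hg : AnalyticOnNhd ℝ (fun t : ℝ => F (x₀ + t • v)) Set.univ := by
      intro t _
      exact (hF _ (Set.mem_univ _)).comp_of_eq (g := F) (by fun_prop) rfl
    have h := hg.preimage_zero_mem_codiscrete (x := 0) (by simpa using hx₀)
    have h' := ae_restrict_le_codiscreteWithin (μ := (volume : Measure ℝ)) MeasurableSet.univ h
    rw [Measure.restrict_univ] at h'
    filter_upwards [h'] with t ht using by simpa using ht
  have hcont : Continuous F := continuousOn_univ.mp hF.continuousOn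
  have hmeas : MeasurableSet {p : E × ℝ | F (x₀ + p.2 • p.1) ≠ 0} :=
    (isOpen_ne_fun (by fun_prop) continuous_const).measurableSet
  have hswap : ∀ᵐ t : ℝ, ∀ᵐ v ∂μ, F (x₀ + t • v) ≠ 0 :=
    (Measure.ae_ae_comm (p := fun v t => F (x₀ + t • v) ≠ 0) hmeas).mp (.of_forall hline)
  obtain ⟨t, ht, ht₀⟩ := (hswap.and (Measure.ae_ne volume (0 : ℝ))).exists
  have hq : Measure.QuasiMeasurePreserving (fun x : E => t⁻¹ • (x - x₀)) μ μ := by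
    refine ⟨by fun_prop, ?_⟩
    have : (fun x : E => t⁻¹ • (x - x₀)) = (fun x => t⁻¹ • x) ∘ fun x => x - x₀ := rfl
    rw [this, ← Measure.map_map (by fun_prop) (by fun_prop),
      (measurePreserving_sub_right μ x₀).map_eq, Measure.map_addHaar_smul μ (inv_ne_zero ht₀)]
    exact Measure.smul_absolutelyContinuous
  filter_upwards [hq.ae ht] with x hx
  simpa [smul_smul, mul_inv_cancel₀ ht₀] using hx

theorem exists_balanced_threshold {ι : Type*} [DecidableEq ι] {a : ι → ℕ}
    (ha : Function.Injective a) {P Q : Finset ι} {L : ℕ} (h : P.card + Q.card = L + L) :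
    ∃ m : ℕ, ((P ∪ Q).filter fun p => p ∈ P ∩ Q ∨ m ≤ a p).card = L ∧
      ((P ∪ Q).filter fun p => p ∈ P ∩ Q ∨ a p < m).card = L := by
  set A : ℕ → ℕ := fun m => ((P ∪ Q).filter fun p => p ∈ P ∩ Q ∨ m ≤ a p).card with hA
  have hcard := Finset.card_union_add_card_inter P Q
  have hsub : P ∩ Q ⊆ P ∪ Q := Finset.inter_subset_left.trans Finset.subset_union_left
  have hle : (P ∩ Q).card ≤ (P ∪ Q).card := Finset.card_le_card hsub
  have hstep : ∀ m, A m ≤ A (m + 1) + 1 := by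
    intro m
    have h1 : ((P ∪ Q).filter fun p => p ∈ P ∩ Q ∨ m ≤ a p) ⊆
        ((P ∪ Q).filter fun p => p ∈ P ∩ Q ∨ m + 1 ≤ a p) ∪ (P ∪ Q).filter fun p => a p = m := by
      intro p
      simp only [Finset.mem_filter, Finset.mem_union]
      rintro ⟨hp, hd | hm⟩
      · exact Or.inl ⟨hp, Or.inl hd⟩
      · rcases hm.eq_or_lt with h | h
        · exact Or.inr ⟨hp, h.symm⟩
        · exact Or.inl ⟨hp, Or.inr h⟩
    have h2 : ((P ∪ Q).filter fun p => a p = m).card ≤ 1 := by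
      rw [Finset.card_le_one]
      intro p hp q hq
      exact ha ((Finset.mem_filter.mp hp).2.trans (Finset.mem_filter.mp hq).2.symm)
    exact (Finset.card_le_card h1).trans ((Finset.card_union_le _ _).trans (by gcongr))
  have hzero : L ≤ A 0 := by
    simp only [hA, Nat.zero_le, or_true, Finset.filter_true]
    omega
  have hex : ∃ m, A m ≤ L := by
    refine ⟨(P ∪ Q).sup a + 1, ?_⟩
    have : ((P ∪ Q).filter fun p => p ∈ P ∩ Q ∨ (P ∪ Q).sup a + 1 ≤ a p) ⊆ P ∩ Q := by
      intro p hp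
      obtain ⟨hp, hd | hm⟩ := Finset.mem_filter.mp hp
      · exact hd
      · have := Finset.le_sup (f := a) hp
        omega
    have := Finset.card_le_card this
    simp only [hA]
    omega
  obtain ⟨m, hm⟩ : ∃ m, A m = L := by
    refine ⟨Nat.find hex, le_antisymm (Nat.find_spec hex) ?_⟩
    rcases hfind : Nat.find hex with _ | m
    · exact hzero
    · have h1 := Nat.find_min hex (m := m) (by omega)
      have h2 := hstep m
      omega
  refine ⟨m, hm, ?_⟩
  have hunion : ((P ∪ Q).filter fun p => p ∈ P ∩ Q ∨ m ≤ a p) ∪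
      ((P ∪ Q).filter fun p => p ∈ P ∩ Q ∨ a p < m) = P ∪ Q := by
    rw [← Finset.filter_or, Finset.filter_true_of_mem]
    intro p _
    rcases le_or_gt m (a p) with h | h <;> simp [h]
  have hinter : ((P ∪ Q).filter fun p => p ∈ P ∩ Q ∨ m ≤ a p) ∩
      ((P ∪ Q).filter fun p => p ∈ P ∩ Q ∨ a p < m) = P ∩ Q := by
    ext p
    have := @hsub p
    simp only [Finset.mem_inter, Finset.mem_filter] at *
    constructor
    · rintro ⟨⟨_, hd | h⟩, _, hd' | h'⟩
      · exact hd
      · exact hd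
      · exact hd'
      · omega
    · intro hd
      exact ⟨⟨this hd, Or.inl hd⟩, this hd, Or.inl hd⟩
  have := Finset.card_union_add_card_inter
    ((P ∪ Q).filter fun p => p ∈ P ∩ Q ∨ m ≤ a p) ((P ∪ Q).filter fun p => p ∈ P ∩ Q ∨ a p < m)
  rw [hunion, hinter] at this
  simp only [hA] at hm
  omega

theorem eq_zero_of_sum_mul_pow_eq_zero {ι : Type*} {L : ℕ} {u : ι → ℂ}
    (hu : Function.Injective u) {S : Finset ι} (hS : S.card = L) {v : Fin L → ℂ}
    (h : ∀ p ∈ S, ∑ l : Fin L, u p ^ (l : ℕ) * v l = 0) : v = 0 := by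
  let e := S.equivFinOfCardEq hS
  refine Matrix.eq_zero_of_forall_index_sum_pow_mul_eq_zero (f := fun j => u (e.symm j)) ?_ ?_
  · exact hu.comp (Subtype.val_injective.comp e.symm.injective)
  · exact fun j => h _ (e.symm j).2

/-- The matrix with rows `(z, z̄)` and `(z, -z̄)` for `z p l = e^{i a_p t_l}`, extended
analytically to complex points `t_l`. -/
noncomputable def expMat {ι : Type*} {L : ℕ} (a : ι → ℕ) (t : Fin L → ℂ) :
    Matrix (ι ⊕ ι) (Fin L ⊕ Fin L) ℂ :=
  Matrix.fromBlocks (Matrix.of fun p l => Complex.exp (Complex.I * (a p * t l)))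
    (Matrix.of fun p l => Complex.exp (-(Complex.I * (a p * t l))))
    (Matrix.of fun p l => Complex.exp (Complex.I * (a p * t l)))
    (Matrix.of fun p l => -Complex.exp (-(Complex.I * (a p * t l))))

theorem exists_det_expMat_ne_zero {ι : Type*} [Finite ι] {L : ℕ} {a : ι → ℕ}
    (ha : Function.Injective a) {τ : ℂ}
    (hu : Function.Injective fun p => Complex.exp (Complex.I * (a p * τ)))
    {f : Fin L ⊕ Fin L → ι ⊕ ι} (hf : Function.Injective f) :
    ∃ s : ℂ, ((expMat a fun l : Fin L => (l : ℂ) * τ + s).submatrix f id).det ≠ 0 := by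
  classical
  cases nonempty_fintype ι
  set u : ι → ℂ := fun p => Complex.exp (Complex.I * (a p * τ)) with hu_def
  have hu' : Function.Injective fun p => (u p)⁻¹ := inv_injective.comp hu
  set P : Finset ι := Finset.univ.filter fun p => ∃ c, f c = Sum.inl p with hP
  set Q : Finset ι := Finset.univ.filter fun p => ∃ c, f c = Sum.inr p with hQ
  have hcard : P.card + Q.card = L + L := by
    rw [← Finset.card_disjSum]
    have : P.disjSum Q = Finset.univ.image f := by
      ext (p | p) <;> simp [hP, hQ]
    rw [this, Finset.card_image_of_injective _ hf]
    simp
  obtain ⟨m, hA, hB⟩ := exists_balanced_threshold ha hcard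
  let κ : ι → ℝ := fun p => (a p : ℝ) - m + 1 / 2
  have hκpos : ∀ p, m ≤ a p → 0 < κ p := by
    intro p hp
    have : (m : ℝ) ≤ a p := by exact_mod_cast hp
    simp only [κ]; linarith
  have hκneg : ∀ p, ¬ m ≤ a p → κ p < 0 := by
    intro p hp
    have : (a p : ℝ) + 1 ≤ m := by exact_mod_cast (not_le.mp hp)
    simp only [κ]; linarith
  let lo : ℝ → ι → ℂ := fun σ p =>
    if m ≤ a p then 1 else Complex.exp (((2 * κ p) * σ : ℝ) : ℂ)
  let hi : ℝ → ι → ℂ := fun σ p =>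
    if m ≤ a p then Complex.exp (((-(2 * κ p)) * σ : ℝ) : ℂ) else 1
  let M : (ι → ℂ) → (ι → ℂ) → Matrix (Fin L ⊕ Fin L) (Fin L ⊕ Fin L) ℂ := fun x y =>
    (Matrix.fromBlocks
      (Matrix.of fun p (l : Fin L) => (if p ∈ P ∩ Q then 1 else x p) * u p ^ (l : ℕ))
      (Matrix.of fun p (l : Fin L) => (if p ∈ P ∩ Q then 0 else y p) * (u p)⁻¹ ^ (l : ℕ))
      (Matrix.of fun p (l : Fin L) => (if p ∈ P ∩ Q then 0 else x p) * u p ^ (l : ℕ))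
      (Matrix.of fun p (l : Fin L) => -((if p ∈ P ∩ Q then 1 else y p) * (u p)⁻¹ ^ (l : ℕ)))).submatrix f id
  let lo' : ι → ℂ := fun p => if m ≤ a p then 1 else 0
  let hi' : ι → ℂ := fun p => if m ≤ a p then 0 else 1
  have hexp : ∀ c : ℝ, c < 0 →
      Tendsto (fun σ : ℝ => Complex.exp ((c * σ : ℝ) : ℂ)) atTop (𝓝 0) := by
    intro c hc
    have h := Real.tendsto_exp_atBot.comp (tendsto_id.const_mul_atTop_of_neg hc)
    have h' := (Complex.continuous_ofReal.tendsto 0).comp h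
    simpa [Function.comp_def] using h'
  have hlo : Tendsto lo atTop (𝓝 lo') := by
    refine tendsto_pi_nhds.mpr fun p => ?_
    by_cases h : m ≤ a p
    · simp [lo, lo', h]
    · simp only [lo, lo', h, if_false]
      exact hexp _ (by linarith [hκneg p h])
  have hhi : Tendsto hi atTop (𝓝 hi') := by
    refine tendsto_pi_nhds.mpr fun p => ?_
    by_cases h : m ≤ a p
    · simp only [hi, hi', h, if_true]
      exact hexp _ (by linarith [hκpos p h])
    · simp [hi, hi', h]
  have hMcont : Continuous fun xy : (ι → ℂ) × (ι → ℂ) => (M xy.1 xy.2).det := by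
    refine Continuous.matrix_det (continuous_matrix fun c d => ?_)
    rcases hc : f c with p | p <;> rcases d with l | l <;> simp only [M, Matrix.submatrix_apply,
      hc, id, Matrix.fromBlocks_apply₁₁, Matrix.fromBlocks_apply₁₂, Matrix.fromBlocks_apply₂₁,
      Matrix.fromBlocks_apply₂₂, Matrix.of_apply] <;> split_ifs <;> fun_prop
  let X : (Fin L ⊕ Fin L → ℂ) → ι → ℂ := fun v p => ∑ l : Fin L, u p ^ (l : ℕ) * v (Sum.inl l)
  let Y : (Fin L ⊕ Fin L → ℂ) → ι → ℂ := fun v p => ∑ l : Fin L, (u p)⁻¹ ^ (l : ℕ) * v (Sum.inr l)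
  have hMinl : ∀ x y v c p, f c = Sum.inl p → (M x y).mulVec v c =
      (if p ∈ P ∩ Q then 1 else x p) * X v p + (if p ∈ P ∩ Q then 0 else y p) * Y v p := by
    intro x y v c p hc
    simp only [M, X, Y, Matrix.mulVec, dotProduct, Fintype.sum_sum_type, Matrix.submatrix_apply,
      hc, id, Matrix.fromBlocks_apply₁₁, Matrix.fromBlocks_apply₁₂, Matrix.of_apply,
      Finset.mul_sum, mul_assoc]
  have hMinr : ∀ x y v c p, f c = Sum.inr p → (M x y).mulVec v c =
      (if p ∈ P ∩ Q then 0 else x p) * X v p - (if p ∈ P ∩ Q then 1 else y p) * Y v p := by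
    intro x y v c p hc
    simp only [M, X, Y, Matrix.mulVec, dotProduct, Fintype.sum_sum_type, Matrix.submatrix_apply,
      hc, id, Matrix.fromBlocks_apply₂₁, Matrix.fromBlocks_apply₂₂, Matrix.of_apply,
      Finset.mul_sum, mul_assoc, neg_mul, Finset.sum_neg_distrib, sub_eq_add_neg]
  have hM₀ : (M lo' hi').det ≠ 0 := by
    intro hdet
    obtain ⟨v, hv, hv0⟩ := Matrix.exists_mulVec_eq_zero_iff.mpr hdet
    have hinl : ∀ c p, f c = Sum.inl p → _ := fun c p hc =>
      (hMinl lo' hi' v c p hc).symm.trans (congrFun hv0 c)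
    have hinr : ∀ c p, f c = Sum.inr p → _ := fun c p hc =>
      (hMinr lo' hi' v c p hc).symm.trans (congrFun hv0 c)
    have hX : (fun l => v (Sum.inl l)) = 0 := by
      refine eq_zero_of_sum_mul_pow_eq_zero hu hA fun p hp => ?_
      change X v p = 0
      obtain ⟨hp, hp'⟩ := Finset.mem_filter.mp hp
      by_cases hd : p ∈ P ∩ Q
      · obtain ⟨c, hc⟩ := (Finset.mem_filter.mp (Finset.mem_inter.mp hd).1).2
        simpa [hd] using hinl c p hc
      · have hm := hp'.resolve_left hd
        rcases Finset.mem_union.mp hp with hp | hp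
        · obtain ⟨c, hc⟩ := (Finset.mem_filter.mp hp).2
          simpa [hd, lo', hi', hm] using hinl c p hc
        · obtain ⟨c, hc⟩ := (Finset.mem_filter.mp hp).2
          simpa [hd, lo', hi', hm] using hinr c p hc
    have hY : (fun l => v (Sum.inr l)) = 0 := by
      refine eq_zero_of_sum_mul_pow_eq_zero hu' hB fun p hp => ?_
      change Y v p = 0
      obtain ⟨hp, hp'⟩ := Finset.mem_filter.mp hp
      by_cases hd : p ∈ P ∩ Q
      · obtain ⟨c, hc⟩ := (Finset.mem_filter.mp (Finset.mem_inter.mp hd).2).2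
        simpa [hd] using hinr c p hc
      · have hm := not_le.mpr (hp'.resolve_left hd)
        rcases Finset.mem_union.mp hp with hp | hp
        · obtain ⟨c, hc⟩ := (Finset.mem_filter.mp hp).2
          simpa [hd, lo', hi', hm] using hinl c p hc
        · obtain ⟨c, hc⟩ := (Finset.mem_filter.mp hp).2
          simpa [hd, lo', hi', hm] using hinr c p hc
    refine hv (funext fun c => ?_)
    rcases c with l | l
    · exact congrFun hX l
    · exact congrFun hY l
  have hM : ∀ᶠ σ in atTop, (M (lo σ) (hi σ)).det ≠ 0 :=
    ((hMcont.tendsto (lo', hi')).comp (hlo.prodMk_nhds hhi)).eventually_ne hM₀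
  obtain ⟨σ, hσ⟩ := hM.exists
  refine ⟨-(Complex.I * σ), fun hdet => hσ ?_⟩
  obtain ⟨v, hv, hv0⟩ := Matrix.exists_mulVec_eq_zero_iff.mpr hdet
  have hE : ∀ (p : ι) (l : Fin L), Complex.exp (Complex.I * (a p * (l * τ + -(Complex.I * σ)))) =
      Complex.exp (a p * σ) * u p ^ (l : ℕ) := by
    intro p l
    rw [hu_def, ← Complex.exp_nat_mul, ← Complex.exp_add]
    congr 1
    linear_combination (-(a p * σ : ℂ)) * Complex.I_mul_I
  have hE' : ∀ (p : ι) (l : Fin L), Complex.exp (-(Complex.I * (a p * (l * τ + -(Complex.I * σ))))) =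
      Complex.exp (-(a p * σ)) * (u p)⁻¹ ^ (l : ℕ) := by
    intro p l
    rw [Complex.exp_neg, hE, Complex.exp_neg, mul_inv, inv_pow]
  have hinl : ∀ c p, f c = Sum.inl p →
      Complex.exp (a p * σ) * X v p + Complex.exp (-(a p * σ)) * Y v p = 0 := by
    intro c p hc
    have := congrFun hv0 c
    simpa only [X, Y, expMat, Matrix.mulVec, dotProduct, Fintype.sum_sum_type,
      Matrix.submatrix_apply, hc, id, Matrix.fromBlocks_apply₁₁, Matrix.fromBlocks_apply₁₂,
      Matrix.of_apply, Finset.mul_sum, mul_assoc, hE, hE', Pi.zero_apply] using this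
  have hinr : ∀ c p, f c = Sum.inr p →
      Complex.exp (a p * σ) * X v p - Complex.exp (-(a p * σ)) * Y v p = 0 := by
    intro c p hc
    have := congrFun hv0 c
    rw [sub_eq_add_neg]
    simpa only [X, Y, expMat, Matrix.mulVec, dotProduct, Fintype.sum_sum_type,
      Matrix.submatrix_apply, hc, id, Matrix.fromBlocks_apply₂₁, Matrix.fromBlocks_apply₂₂,
      Matrix.of_apply, Finset.mul_sum, mul_assoc, hE, hE', neg_mul, Finset.sum_neg_distrib,
      Pi.zero_apply] using this
  let w : ℂ := Complex.exp (((m : ℝ) - 1 / 2 : ℝ) * σ)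
  have hw : w ≠ 0 := Complex.exp_ne_zero _
  let v' : Fin L ⊕ Fin L → ℂ := Sum.elim (fun l => w * v (Sum.inl l)) fun l => w⁻¹ * v (Sum.inr l)
  have hX' : ∀ p, X v' p = w * X v p := fun p => by
    simp only [X, v', Sum.elim_inl, Finset.mul_sum, mul_left_comm]
  have hY' : ∀ p, Y v' p = w⁻¹ * Y v p := fun p => by
    simp only [Y, v', Sum.elim_inr, Finset.mul_sum, mul_left_comm]
  have hlow : ∀ p, ¬ m ≤ a p → lo σ p * w =
      Complex.exp (κ p * σ) * Complex.exp (a p * σ) ∧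
      hi σ p * w⁻¹ = Complex.exp (κ p * σ) * Complex.exp (-(a p * σ)) := by
    intro p hp
    simp only [lo, hi, hp, if_false, w, ← Complex.exp_neg, one_mul, ← Complex.exp_add, κ]
    constructor <;> congr 1 <;> push_cast <;> ring
  have hhigh : ∀ p, m ≤ a p → lo σ p * w =
      Complex.exp (-(κ p * σ)) * Complex.exp (a p * σ) ∧
      hi σ p * w⁻¹ = Complex.exp (-(κ p * σ)) * Complex.exp (-(a p * σ)) := by
    intro p hp
    simp only [lo, hi, hp, if_true, w, ← Complex.exp_neg, one_mul, ← Complex.exp_add, κ]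
    constructor <;> congr 1 <;> push_cast <;> ring
  obtain ⟨e, he⟩ : ∃ e : ι → ℂ, ∀ p, lo σ p * w = e p * Complex.exp (a p * σ) ∧
      hi σ p * w⁻¹ = e p * Complex.exp (-(a p * σ)) := by
    refine ⟨fun p => if m ≤ a p then Complex.exp (-(κ p * σ)) else Complex.exp (κ p * σ),
      fun p => ?_⟩
    by_cases hp : m ≤ a p
    · simpa only [hp, if_true] using hhigh p hp
    · simpa only [hp, if_false] using hlow p hp
  have hdouble : ∀ p ∈ P ∩ Q, X v p = 0 ∧ Y v p = 0 := by
    intro p hp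
    obtain ⟨c, hc⟩ := (Finset.mem_filter.mp (Finset.mem_inter.mp hp).1).2
    obtain ⟨d, hd⟩ := (Finset.mem_filter.mp (Finset.mem_inter.mp hp).2).2
    have h1 := hinl c p hc
    have h2 := hinr d p hd
    have h3 : Complex.exp (a p * σ) * X v p = 0 := by linear_combination (h1 + h2) / 2
    have h4 : Complex.exp (-(a p * σ)) * Y v p = 0 := by linear_combination (h1 - h2) / 2
    exact ⟨(mul_eq_zero.mp h3).resolve_left (Complex.exp_ne_zero _),
      (mul_eq_zero.mp h4).resolve_left (Complex.exp_ne_zero _)⟩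
  refine Matrix.exists_mulVec_eq_zero_iff.mp ⟨v', ?_, funext fun c => ?_⟩
  · contrapose! hv
    refine funext fun c => ?_
    rcases c with l | l
    · exact (mul_eq_zero.mp (congrFun hv (Sum.inl l))).resolve_left hw
    · exact (mul_eq_zero.mp (congrFun hv (Sum.inr l))).resolve_left (inv_ne_zero hw)
  · rcases hc : f c with p | p
    · rw [hMinl _ _ _ c p hc, hX', hY']
      by_cases hp : p ∈ P ∩ Q
      · simp [hdouble p hp]
      · simp only [hp, if_false, Pi.zero_apply]
        linear_combination X v p * (he p).1 + Y v p * (he p).2 + e p * hinl c p hc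
    · rw [hMinr _ _ _ c p hc, hX', hY']
      by_cases hp : p ∈ P ∩ Q
      · simp [hdouble p hp]
      · simp only [hp, if_false, Pi.zero_apply]
        linear_combination X v p * (he p).1 - Y v p * (he p).2 + e p * hinr c p hc

theorem exists_small_det_expMat_ne_zero {ι : Type*} [Finite ι] {L : ℕ} {a : ι → ℕ}
    (ha : Function.Injective a) {f : Fin L ⊕ Fin L → ι ⊕ ι} (hf : Function.Injective f)
    {ε : ℝ} (hε : 0 < ε) :
    ∃ t : Fin L → ℝ, (∀ l, |t l| < ε) ∧
      ((expMat a fun l => (t l : ℂ)).submatrix f id).det ≠ 0 := by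
  cases nonempty_fintype ι
  obtain ⟨τ, hτ₀, hτa, hτL⟩ : ∃ τ : ℝ, 0 < τ ∧ (∀ p, a p * τ < 1) ∧ L * τ < ε / 2 := by
    have h : ∀ c r : ℝ, 0 < r → ∀ᶠ τ : ℝ in 𝓝[>] 0, c * τ < r := fun c r hr =>
      ((continuous_const.mul continuous_id).tendsto' 0 0 (by simp)).mono_left nhdsWithin_le_nhds
        |>.eventually_lt_const hr
    exact ((eventually_mem_nhdsWithin (s := Set.Ioi (0 : ℝ))).and ((eventually_all.mpr fun p => h (a p) 1 one_pos).and
      (h L (ε / 2) (half_pos hε)))).exists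
  have hu : Function.Injective fun p => Complex.exp (Complex.I * (a p * (τ : ℂ))) := by
    intro p q hpq
    have him : ∀ p, (Complex.I * (a p * (τ : ℂ))).im = a p * τ := by intro p; simp
    have hlow : ∀ p, -Real.pi < (Complex.I * (a p * (τ : ℂ))).im := fun p => by
      rw [him]
      have : 0 ≤ a p * τ := by positivity
      linarith [Real.pi_pos]
    have hhigh : ∀ p, (Complex.I * (a p * (τ : ℂ))).im ≤ Real.pi := fun p => by
      rw [him]
      linarith [Real.pi_gt_three, hτa p]
    have h := congrArg Complex.im
      (Complex.exp_inj_of_neg_pi_lt_of_le_pi (hlow p) (hhigh p) (hlow q) (hhigh q) hpq)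
    rw [him, him] at h
    exact ha (by exact_mod_cast mul_right_cancel₀ hτ₀.ne' h)
  obtain ⟨s₀, hs₀⟩ := exists_det_expMat_ne_zero ha hu hf
  set g : ℂ → ℂ := fun s => ((expMat a fun l : Fin L => (l : ℂ) * τ + s).submatrix f id).det
    with hg
  have hdiff : Differentiable ℂ g := by
    simp only [hg, Matrix.det_apply, Matrix.submatrix_apply, id]
    refine Differentiable.fun_sum fun σ _ => Differentiable.const_smul ?_ _
    refine Differentiable.fun_finsetProd fun c _ => ?_
    rcases f (σ c) with p | p <;> rcases c with l | l <;>
      simp only [expMat, Matrix.fromBlocks_apply₁₁, Matrix.fromBlocks_apply₁₂,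
        Matrix.fromBlocks_apply₂₁, Matrix.fromBlocks_apply₂₂, Matrix.of_apply] <;> fun_prop
  have hne : ∀ᶠ s in 𝓝[≠] (0 : ℂ), g s ≠ 0 := by
    by_contra hfreq
    refine hs₀ (congrFun (AnalyticOnNhd.eq_of_frequently_eq (g := 0) (z₀ := 0)
      (fun z _ => hdiff.analyticAt z) (fun z _ => analyticAt_const) ?_) s₀)
    exact Filter.not_eventually.mp hfreq |>.mono fun s hs => not_not.mp hs
  have hreal : Tendsto (fun s : ℝ => (s : ℂ)) (𝓝[≠] 0) (𝓝[≠] 0) :=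
    tendsto_nhdsWithin_of_tendsto_nhds_of_eventually_within _
      ((Complex.continuous_ofReal.tendsto' 0 0 (by simp)).mono_left nhdsWithin_le_nhds)
      (eventually_mem_nhdsWithin.mono fun s hs => by simpa using hs)
  have hsmall : ∀ᶠ s : ℝ in 𝓝[≠] 0, |s| < ε / 2 :=
    ((continuous_abs.tendsto' (0 : ℝ) 0 (by simp)).mono_left nhdsWithin_le_nhds).eventually_lt_const
      (half_pos hε)
  obtain ⟨s, hs, hsε⟩ := ((hreal.eventually hne).and hsmall).exists
  refine ⟨fun l => l * τ + s, fun l => ?_, ?_⟩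
  · have h1 : (l : ℝ) * τ ≤ L * τ := by gcongr; exact l.2.le
    have h2 : 0 ≤ (l : ℝ) * τ := by positivity
    rw [abs_lt] at *
    constructor <;> linarith
  · simpa [hg] using hs

theorem det_realification_ne_zero {ι κ : Type*} [Fintype κ] [DecidableEq κ]
    (z : Matrix ι κ ℂ) (f : κ ⊕ κ → ι ⊕ ι)
    (h : ((Matrix.fromBlocks z (z.map star) z (-z.map star)).submatrix f id).det ≠ 0) :
    ((Matrix.fromBlocks (z.map Complex.re) (-z.map Complex.im) (z.map Complex.im)
      (z.map Complex.re)).submatrix f id).det ≠ 0 := by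
  contrapose! h
  obtain ⟨v, hv, hv0⟩ := Matrix.exists_mulVec_eq_zero_iff.mpr h
  let α : κ → ℂ := fun l => ⟨v (Sum.inl l), v (Sum.inr l)⟩
  refine Matrix.exists_mulVec_eq_zero_iff.mp ⟨Sum.elim α (star α), ?_, funext fun c => ?_⟩
  · contrapose! hv
    refine funext fun c => ?_
    rcases c with l | l
    · exact congrArg Complex.re (congrFun hv (Sum.inl l))
    · exact congrArg Complex.im (congrFun hv (Sum.inl l))
  · have hc0 := congrFun hv0 c
    rcases hc : f c with p | p
    · have hre : (∑ l, z p l * α l).re = 0 := by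
        simpa [Matrix.mulVec, dotProduct, Fintype.sum_sum_type, hc, Complex.mul_re, α,
          Finset.sum_sub_distrib, sub_eq_add_neg, Finset.sum_add_distrib] using hc0
      have : (∑ l, z p l * α l) + star (∑ l, z p l * α l) = 0 := by
        rw [Complex.star_def, Complex.add_conj, hre]; simp
      simpa [Matrix.mulVec, dotProduct, Fintype.sum_sum_type, hc] using this
    · have him : (∑ l, z p l * α l).im = 0 := by
        rw [Pi.zero_apply] at hc0
        rw [← hc0]
        simp [Matrix.mulVec, dotProduct, Fintype.sum_sum_type, hc, Complex.mul_im, α,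
          Finset.sum_add_distrib, add_comm]
      have : (∑ l, z p l * α l) - star (∑ l, z p l * α l) = 0 := by
        rw [Complex.star_def, Complex.sub_conj, him]; simp
      simpa [Matrix.mulVec, dotProduct, Fintype.sum_sum_type, hc, sub_eq_add_neg] using this

theorem exists_angles {x y : ℝ} (hx : |x| ≤ 1 / 2) (hy : |y| ≤ 1 / 2) :
    ∃ φ θ : ℝ, Real.sin φ * Real.sin θ = x ∧ Real.cos θ = y := by
  have hx2 : x ^ 2 ≤ 1 / 4 := by rw [← sq_abs]; nlinarith [abs_nonneg x]
  have hy2 : y ^ 2 ≤ 1 / 4 := by rw [← sq_abs]; nlinarith [abs_nonneg y]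
  have hpos : 0 < √(1 - y ^ 2) := Real.sqrt_pos.mpr (by linarith)
  have hle : |x / √(1 - y ^ 2)| ≤ 1 := by
    rw [abs_div, abs_of_pos hpos, div_le_one hpos]
    exact Real.abs_le_sqrt (by linarith)
  rw [abs_le] at hle hy
  refine ⟨Real.arcsin (x / √(1 - y ^ 2)), Real.arccos y, ?_,
    Real.cos_arccos (by linarith) (by linarith)⟩
  rw [Real.sin_arcsin hle.1 hle.2, Real.sin_arccos, div_mul_cancel₀ _ hpos.ne']

theorem upaRealMat_eq_fromBlocks (Y Z L : ℕ) (k : ℝ) (ang : (Fin L → ℝ) × (Fin L → ℝ)) :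
    upaRealMat Y Z L k ang =
      let z : Matrix (Fin Y × Fin Z) (Fin L) ℂ :=
        Matrix.of fun p l => upaEntry Y Z k (ang.1 l) (ang.2 l) p
      Matrix.fromBlocks (z.map Complex.re) (-z.map Complex.im) (z.map Complex.im)
        (z.map Complex.re) := by
  ext (p | p) (l | l) <;> rfl

theorem analyticOnNhd_upaRealMat (Y Z L : ℕ) (k : ℝ)
    (r : (Fin Y × Fin Z) ⊕ (Fin Y × Fin Z)) (c : Fin L ⊕ Fin L) :
    AnalyticOnNhd ℝ (fun ang => upaRealMat Y Z L k ang r c) Set.univ := by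
  intro ang _
  have hfst : ∀ l : Fin L, AnalyticAt ℝ (fun x : (Fin L → ℝ) × (Fin L → ℝ) => x.1 l) ang :=
    fun l => ((ContinuousLinearMap.proj (R := ℝ) (φ := fun _ : Fin L => ℝ) l).comp
      (ContinuousLinearMap.fst ℝ _ _)).analyticAt ang
  have hsnd : ∀ l : Fin L, AnalyticAt ℝ (fun x : (Fin L → ℝ) × (Fin L → ℝ) => x.2 l) ang :=
    fun l => ((ContinuousLinearMap.proj (R := ℝ) (φ := fun _ : Fin L => ℝ) l).comp
      (ContinuousLinearMap.snd ℝ _ _)).analyticAt ang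
  have hentry : ∀ (p : Fin Y × Fin Z) (l : Fin L), AnalyticAt ℝ
      (fun x : (Fin L → ℝ) × (Fin L → ℝ) => upaEntry Y Z k (x.1 l) (x.2 l) p) ang := by
    intro p l
    have hphase : AnalyticAt ℝ (fun x : (Fin L → ℝ) × (Fin L → ℝ) => k * ((p.1 : ℝ) *
        Real.sin (x.1 l) * Real.sin (x.2 l) + (p.2 : ℝ) * Real.cos (x.2 l))) ang :=
      analyticAt_const.mul (((analyticAt_const.mul (Real.analyticAt_sin.comp (hfst l))).mul
        (Real.analyticAt_sin.comp (hsnd l))).add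
          (analyticAt_const.mul (Real.analyticAt_cos.comp (hsnd l))))
    exact analyticAt_const.mul ((analyticAt_cexp.restrictScalars (𝕜 := ℝ)).comp
      (analyticAt_const.mul ((Complex.ofRealCLM.analyticAt _).comp hphase)))
  rcases r with p | p <;> rcases c with l | l
  · exact (Complex.reCLM.analyticAt _).comp (hentry p l)
  · exact ((Complex.imCLM.analyticAt _).comp (hentry p l)).neg
  · exact (Complex.imCLM.analyticAt _).comp (hentry p l)
  · exact (Complex.reCLM.analyticAt _).comp (hentry p l)

theorem exists_det_upaRealMat_ne_zero {Y Z L : ℕ} (hY : 0 < Y) (hZ : 0 < Z) {k : ℝ} (hk : k ≠ 0)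
    {f : Fin L ⊕ Fin L → (Fin Y × Fin Z) ⊕ (Fin Y × Fin Z)} (hf : Function.Injective f) :
    ∃ ang, ((upaRealMat Y Z L k ang).submatrix f id).det ≠ 0 := by
  have hZ' : (1 : ℝ) ≤ Z := by exact_mod_cast hZ
  have hk' : 0 < |k| := abs_pos.mpr hk
  obtain ⟨t, ht, hdet⟩ := exists_small_det_expMat_ne_zero (a := fun p => (finProdFinEquiv p : ℕ))
    (Fin.val_injective.comp (finProdFinEquiv (m := Y) (n := Z)).injective) hf
    (ε := |k| / (2 * Z)) (by positivity)
  have hx : ∀ l, |Z * t l / k| ≤ 1 / 2 := by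
    intro l
    have := (lt_div_iff₀ (by positivity)).mp (ht l)
    rw [abs_div, div_le_iff₀ hk', abs_mul, abs_of_pos (by positivity : (0 : ℝ) < Z)]
    linarith
  have hy : ∀ l, |t l / k| ≤ 1 / 2 := by
    intro l
    have := (lt_div_iff₀ (by positivity)).mp (ht l)
    rw [abs_div, div_le_iff₀ hk']
    nlinarith [abs_nonneg (t l)]
  choose φ θ hφ hθ using fun l => exists_angles (hx l) (hy l)
  refine ⟨(φ, θ), ?_⟩
  rw [upaRealMat_eq_fromBlocks]
  refine det_realification_ne_zero _ f ?_
  set c : ℂ := ((1 / Real.sqrt ((Y : ℝ) * Z) : ℝ) : ℂ) with hc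
  have hc0 : c ≠ 0 := by
    rw [hc, Complex.ofReal_ne_zero]
    positivity
  have hentry : ∀ p l, upaEntry Y Z k (φ l) (θ l) p =
      c * Complex.exp (Complex.I * (((finProdFinEquiv p : ℕ) : ℂ) * t l)) := by
    intro p l
    have hphase : k * ((p.1 : ℝ) * Real.sin (φ l) * Real.sin (θ l) + (p.2 : ℝ) * Real.cos (θ l)) =
        ((finProdFinEquiv p : ℕ) : ℝ) * t l := by
      rw [mul_assoc (p.1 : ℝ), hφ, hθ, finProdFinEquiv_apply_val]
      push_cast
      field_simp
      ring
    rw [upaEntry, hphase, ← hc]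
    push_cast
    rfl
  have hstar : ∀ p l, star (upaEntry Y Z k (φ l) (θ l) p) =
      c * Complex.exp (-(Complex.I * (((finProdFinEquiv p : ℕ) : ℂ) * t l))) := by
    intro p l
    rw [hentry, Complex.star_def, map_mul, ← Complex.exp_conj]
    simp [hc]
  rw [show ∀ A B : Matrix (Fin L ⊕ Fin L) (Fin L ⊕ Fin L) ℂ, A = c • B → A.det = _ from
    fun A B h => h ▸ Matrix.det_smul B c]
  · exact mul_ne_zero (pow_ne_zero _ hc0) hdet
  · ext i j
    rcases hi : f i with p | p <;> rcases j with l | l <;>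
      simp only [expMat, hi, hstar, id, Matrix.submatrix_apply, Matrix.smul_apply, smul_eq_mul,
        Matrix.fromBlocks_apply₁₁, Matrix.fromBlocks_apply₁₂, Matrix.fromBlocks_apply₂₁,
        Matrix.fromBlocks_apply₂₂, Matrix.of_apply, Matrix.map_apply, Matrix.neg_apply,
        mul_neg] <;>
      exact hentry p l

/-- For almost every choice of azimuth/elevation angles (w.r.t. Lebesgue measure),
the real `2N × 2L` matrix `[Re A, -Im A; Im A, Re A]` built from `L ≤ N = YZ` UPA
array response vectors has every `2L × 2L` submatrix invertible, i.e., its rows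
are in general position. -/
theorem upa_general_position_ae (Y Z L : ℕ) (hY : 0 < Y) (hZ : 0 < Z)
    (hL : 0 < L) (hLN : L ≤ Y * Z) (k : ℝ) (hk : k ≠ 0) :
    ∀ᵐ ang : (Fin L → ℝ) × (Fin L → ℝ) ∂MeasureTheory.volume,
      ∀ f : Fin (L + L) → ((Fin Y × Fin Z) ⊕ (Fin Y × Fin Z)),
        Function.Injective f →
        ((upaRealMat Y Z L k ang).submatrix f
            (fun j : Fin (L + L) => finSumFinEquiv.symm j)).det ≠ 0 := by
  rw [ae_all_iff]
  refine fun f => eventually_imp_distrib_left.mpr fun hf => ?_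
  have hdet : ∀ ang, ((upaRealMat Y Z L k ang).submatrix f
      (fun j : Fin (L + L) => finSumFinEquiv.symm j)).det =
      ((upaRealMat Y Z L k ang).submatrix (f ∘ finSumFinEquiv) id).det := by
    intro ang
    rw [← Matrix.det_submatrix_equiv_self finSumFinEquiv, Matrix.submatrix_submatrix]
    congr 2
    ext j
    simp
  obtain ⟨ang₀, h₀⟩ := exists_det_upaRealMat_ne_zero hY hZ hk
    (hf.comp (finSumFinEquiv (m := L) (n := L)).injective)
  simp only [hdet]
  have : (volume : Measure ((Fin L → ℝ) × (Fin L → ℝ))).IsAddHaarMeasure :=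
    Measure.prod.instIsAddHaarMeasure (volume : Measure (Fin L → ℝ)) (volume : Measure (Fin L → ℝ))
  refine ae_ne_zero_of_analyticOnNhd volume (fun ang _ => ?_) h₀
  simp only [Matrix.det_apply, Units.smul_def, zsmul_eq_mul]
  exact Finset.analyticAt_fun_sum _ fun σ _ => analyticAt_const.mul
    (Finset.analyticAt_fun_prod _ fun i _ => analyticOnNhd_upaRealMat Y Z L k _ _ ang (Set.mem_univ _))
end
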